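/- Let (X_t : t ∈ ℝ) be a zero-mean stationary Gaussian process with covariance kernel R(t) = ∫ e^{itx} μ(dx), where μ is a finite non-null symmetric measure on ℝ with μ([x,∞)) > 0 for all x > 0 and μ([x,∞)) regularly varying with index −α, 0 < α < 2. Let Z_t = X_t − (R(t)/R(0)) X_0 and δ_u = (h(u^{−2}))^{−1} with h(y) = inf{x ≥ 0 : μ([x,∞)) ≤ y}. Then for fixed s, t ∈ ℝ, E(Z_{sδ_u} Z_{tδ_u}) = [R(0) − R(sδ_u)] + [R(0) − R(tδ_u)] − [R(0) − R((s−t)δ_u)] − R(0)^{−1}[R(sδ_u) − R(0)][R(tδ_u) − R(0)], and E(Z_{sδ_u} Z_{tδ_u}) ~ C_α u^{−2} (|s|^α + |t|^α − |s−t|^α) as u → ∞ (when s, t, s−t are not all such that the right side vanishes, the asymptotic equivalence holds with the stated constant), where C_α = π/(Γ(α) sin(πα/2)). -/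

import Mathlib

open MeasureTheory ProbabilityTheory Filter

/-- A real-valued stochastic process is a (zero-mean) Gaussian process if every finite
linear combination of its values has a centered Gaussian distribution. -/
def IsZeroMeanGaussianProcess {Ω : Type*} [MeasurableSpace Ω] (P : Measure Ω)
    (X : ℝ → Ω → ℝ) : Prop :=
  (∀ t, Measurable (X t)) ∧
  ∀ (n : ℕ) (t : Fin n → ℝ) (c : Fin n → ℝ),
    ∃ v : NNReal, P.map (fun ω => ∑ i, c i * X (t i) ω) = gaussianReal 0 v

lemma lintegral_ofReal_eq_of_integral_eq {X : Type*} [MeasurableSpace X] {ν : Measure X}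
    {f : X → ℝ} {c : ℝ} (hf : 0 ≤ᵐ[ν] f) (hc : 0 < c) (h : ∫ x, f x ∂ν = c) :
    ∫⁻ x, ENNReal.ofReal (f x) ∂ν = ENNReal.ofReal c := by
  have hi : Integrable f ν := by
    by_contra hn
    rw [integral_undef hn] at h
    exact hc.ne h
  rw [← ofReal_integral_eq_lintegral_ofReal hi hf, h]

lemma lintegral_Ioi_congr_of_swap {k : ℝ → ℝ → ℝ} {f g : ℝ → ℝ}
    (hk : Measurable (Function.uncurry k))
    (hf : ∀ x > 0, ∫⁻ y in Set.Ioi 0, ENNReal.ofReal (k x y) = ENNReal.ofReal (f x))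
    (hg : ∀ y > 0, ∫⁻ x in Set.Ioi 0, ENNReal.ofReal (k x y) = ENNReal.ofReal (g y)) :
    ∫⁻ x in Set.Ioi 0, ENNReal.ofReal (f x) = ∫⁻ y in Set.Ioi 0, ENNReal.ofReal (g y) := by
  rw [← setLIntegral_congr_fun measurableSet_Ioi hf, ← setLIntegral_congr_fun measurableSet_Ioi hg]
  exact lintegral_lintegral_swap (ENNReal.measurable_ofReal.comp hk).aemeasurable

lemma lintegral_rpow_div_one_add_sq {α : ℝ} (hα0 : 0 < α) (hα2 : α < 2) :
    ∫⁻ l in Set.Ioi (0 : ℝ), ENNReal.ofReal (l ^ (α - 1) / (1 + l ^ 2)) =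
      ENNReal.ofReal (Real.pi / (2 * Real.sin (Real.pi * α / 2))) := by
  have hG : 0 < Real.Gamma (α / 2) := Real.Gamma_pos_of_pos (by linarith)
  have hG' : 0 < Real.Gamma (1 - α / 2) := Real.Gamma_pos_of_pos (by linarith)
  rw [lintegral_Ioi_congr_of_swap
    (k := fun l v => l ^ (α - 1) * Real.exp (-((1 + l ^ 2) * v)))
    (g := fun v => Real.Gamma (α / 2) / 2 * (v ^ ((1 - α / 2) - 1) * Real.exp (-(1 * v))))
    (by unfold Function.uncurry; fun_prop)]
  · apply lintegral_ofReal_eq_of_integral_eq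
    · filter_upwards [ae_restrict_mem measurableSet_Ioi] with v hv
      have : (0 : ℝ) < v := hv
      simp only [Pi.zero_apply]
      positivity
    · have : 0 < Real.sin (Real.pi * α / 2) :=
        Real.sin_pos_of_pos_of_lt_pi (by positivity) (by nlinarith [Real.pi_pos])
      positivity
    · rw [integral_const_mul, Real.integral_rpow_mul_exp_neg_mul_Ioi (by linarith) one_pos]
      have := Real.Gamma_mul_Gamma_one_sub (α / 2)
      rw [← mul_div_assoc] at this
      rw [div_one, Real.one_rpow, one_mul, div_mul_eq_mul_div, this, div_div, mul_comm (2 : ℝ)]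
  · intro l hl
    have hl' : (0 : ℝ) < l := hl
    apply lintegral_ofReal_eq_of_integral_eq
    · filter_upwards with v
      simp only [Pi.zero_apply]
      positivity
    · positivity
    · rw [integral_const_mul]
      have := Real.integral_rpow_mul_exp_neg_mul_Ioi one_pos
        (show 0 < 1 + l ^ 2 by positivity)
      simp only [sub_self, Real.rpow_zero, one_mul, Real.rpow_one, Real.Gamma_one, mul_one] at this
      rw [this, mul_one_div]
  · intro v hv
    have hv' : (0 : ℝ) < v := hv
    apply lintegral_ofReal_eq_of_integral_eq
    · filter_upwards [ae_restrict_mem measurableSet_Ioi] with l hl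
      have : (0 : ℝ) < l := hl
      simp only [Pi.zero_apply]
      positivity
    · positivity
    · have h1 := integral_rpow_mul_exp_neg_mul_rpow (p := 2) (q := α - 1) two_pos
        (by linarith) hv'
      have h2 : ∀ l : ℝ, l ^ (α - 1) * Real.exp (-((1 + l ^ 2) * v)) =
          Real.exp (-v) * (l ^ (α - 1) * Real.exp (-v * l ^ (2 : ℝ))) := by
        intro l
        rw [mul_left_comm, ← Real.exp_add, Real.rpow_two]
        congr 2
        ring
      simp_rw [h2]
      rw [integral_const_mul, h1]
      ring_nf

lemma tendsto_exp_neg_mul_mul_zero {l C : ℝ} (hl : 0 < l) {f : ℝ → ℝ} (hf : ∀ x, |f x| ≤ C) :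
    Tendsto (fun x => Real.exp (-(l * x)) * f x) atTop (nhds 0) := by
  have h : Tendsto (fun x => Real.exp (-(l * x)) * C) atTop (nhds 0) := by
    have : Tendsto (fun x : ℝ => l * x) atTop atTop := tendsto_id.const_mul_atTop hl
    simpa using (Real.tendsto_exp_neg_atTop_nhds_zero.comp this).mul_const C
  refine squeeze_zero_norm (fun x => ?_) h
  rw [norm_mul, Real.norm_eq_abs, Real.abs_exp]
  exact mul_le_mul_of_nonneg_left (hf x) (Real.exp_pos _).le

lemma integral_one_sub_cos_mul_exp {l : ℝ} (hl : 0 < l) :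
    ∫ z in Set.Ioi (0 : ℝ), (1 - Real.cos z) * Real.exp (-(l * z)) = 1 / (l * (1 + l ^ 2)) := by
  have hd : ∀ x ∈ Set.Ici (0 : ℝ), HasDerivAt
      (fun z => Real.exp (-(l * z)) * (-(1 / l) - (Real.sin z - l * Real.cos z) / (1 + l ^ 2)))
      ((1 - Real.cos x) * Real.exp (-(l * x))) x := by
    intro x _
    have h1 : HasDerivAt (fun z : ℝ => Real.exp (-(l * z))) (Real.exp (-(l * x)) * -(l * 1)) x :=
      ((hasDerivAt_id x).const_mul l).neg.exp
    have h2 : HasDerivAt (fun z => -(1 / l) - (Real.sin z - l * Real.cos z) / (1 + l ^ 2))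
        (-((Real.cos x - l * -Real.sin x) / (1 + l ^ 2))) x :=
      ((((Real.hasDerivAt_sin x).sub ((Real.hasDerivAt_cos x).const_mul l)).div_const _).const_sub _)
    refine (h1.mul h2).congr_deriv ?_
    field_simp
    ring
  rw [integral_Ioi_of_hasDerivAt_of_nonneg' hd (l := 0)]
  · simp
    field_simp
    ring
  · intro x _
    exact mul_nonneg (by linarith [Real.cos_le_one x]) (Real.exp_pos _).le
  · refine tendsto_exp_neg_mul_mul_zero hl (C := 1 / l + (1 + l) / (1 + l ^ 2)) fun x => ?_
    have h3 : |Real.sin x - l * Real.cos x| ≤ 1 + l := by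
      refine (abs_sub _ _).trans (add_le_add (Real.abs_sin_le_one x) ?_)
      rw [abs_mul, abs_of_pos hl]
      exact mul_le_of_le_one_right hl.le (Real.abs_cos_le_one x)
    refine (abs_sub _ _).trans (add_le_add ?_ ?_)
    · rw [abs_neg, abs_of_pos (by positivity)]
    · rw [abs_div, abs_of_pos (show 0 < 1 + l ^ 2 by positivity)]
      gcongr

lemma lintegral_one_sub_cos_mul_rpow {α : ℝ} (hα0 : 0 < α) (hα2 : α < 2) :
    ∫⁻ z in Set.Ioi (0 : ℝ), ENNReal.ofReal
        (α * ((1 - Real.cos z) * z ^ (-α - 1))) =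
      ENNReal.ofReal (Real.pi / (2 * (Real.Gamma α * Real.sin (Real.pi * α / 2)))) := by
  have hG : 0 < Real.Gamma α := Real.Gamma_pos_of_pos hα0
  rw [lintegral_Ioi_congr_of_swap
    (k := fun z l => (1 / Real.Gamma α) * ((1 - Real.cos z) *
      (l ^ ((α + 1) - 1) * Real.exp (-(z * l)))))
    (g := fun l => (1 / Real.Gamma α) * (l ^ (α - 1) / (1 + l ^ 2)))
    (by unfold Function.uncurry; fun_prop)]
  · simp_rw [ENNReal.ofReal_mul (one_div_nonneg.2 hG.le)]
    rw [lintegral_const_mul' _ _ ENNReal.ofReal_ne_top, lintegral_rpow_div_one_add_sq hα0 hα2,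
      ← ENNReal.ofReal_mul (one_div_nonneg.2 hG.le)]
    congr 1
    rw [div_mul_div_comm, one_mul]
    congr 1
    ring
  · intro z hz
    have hz' : (0 : ℝ) < z := hz
    have hc : 0 ≤ 1 - Real.cos z := by linarith [Real.cos_le_one z]
    have hI := Real.integral_rpow_mul_exp_neg_mul_Ioi (show 0 < α + 1 by linarith) hz'
    have h1 : ∫⁻ l in Set.Ioi (0 : ℝ), ENNReal.ofReal
        (l ^ ((α + 1) - 1) * Real.exp (-(z * l))) =
          ENNReal.ofReal ((1 / z) ^ (α + 1) * Real.Gamma (α + 1)) := by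
      refine lintegral_ofReal_eq_of_integral_eq ?_ ?_ hI
      · filter_upwards [ae_restrict_mem measurableSet_Ioi] with l hl
        have : (0 : ℝ) < l := hl
        simp only [Pi.zero_apply]
        positivity
      · have := Real.Gamma_pos_of_pos (show 0 < α + 1 by linarith)
        positivity
    simp_rw [ENNReal.ofReal_mul (one_div_nonneg.2 hG.le), ENNReal.ofReal_mul hc]
    rw [lintegral_const_mul' _ _ ENNReal.ofReal_ne_top, lintegral_const_mul' _ _
      ENNReal.ofReal_ne_top, h1, ← ENNReal.ofReal_mul hc,
      ← ENNReal.ofReal_mul (one_div_nonneg.2 hG.le), Real.Gamma_add_one hα0.ne', one_div z,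
      Real.inv_rpow hz'.le, ← Real.rpow_neg hz'.le, neg_add, ← sub_eq_add_neg]
    congr 1
    field_simp
  · intro l hl
    have hl' : (0 : ℝ) < l := hl
    apply lintegral_ofReal_eq_of_integral_eq
    · filter_upwards with z
      have hc : 0 ≤ 1 - Real.cos z := by linarith [Real.cos_le_one z]
      simp only [Pi.zero_apply]
      positivity
    · positivity
    · have h2 : ∀ z, (1 / Real.Gamma α) * ((1 - Real.cos z) *
          (l ^ ((α + 1) - 1) * Real.exp (-(z * l)))) =
          (1 / Real.Gamma α * l ^ α) * ((1 - Real.cos z) * Real.exp (-(l * z))) := by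
        intro z
        rw [mul_comm z l, add_sub_cancel_right]
        ring
      simp_rw [h2]
      rw [integral_const_mul, integral_one_sub_cos_mul_exp hl', Real.rpow_sub_one hl'.ne']
      field_simp

lemma one_sub_cos_mul_rpow_nonneg {z β : ℝ} (hz : 0 < z) : 0 ≤ (1 - Real.cos z) * z ^ β :=
  mul_nonneg (by linarith [Real.cos_le_one z]) (Real.rpow_nonneg hz.le _)

lemma integrableOn_one_sub_cos_mul_rpow {α : ℝ} (hα0 : 0 < α) (hα2 : α < 2) :
    IntegrableOn (fun z : ℝ => α * ((1 - Real.cos z) * z ^ (-α - 1))) (Set.Ioi 0) := by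
  refine (lintegral_ofReal_ne_top_iff_integrable ?_ ?_).1 ?_
  · exact Measurable.aestronglyMeasurable (by fun_prop)
  · filter_upwards [ae_restrict_mem measurableSet_Ioi] with z hz
    exact mul_nonneg hα0.le (one_sub_cos_mul_rpow_nonneg hz)
  · rw [lintegral_one_sub_cos_mul_rpow hα0 hα2]
    exact ENNReal.ofReal_ne_top

lemma integral_one_sub_cos_mul_rpow {α : ℝ} (hα0 : 0 < α) (hα2 : α < 2) :
    ∫ z in Set.Ioi (0 : ℝ), α * ((1 - Real.cos z) * z ^ (-α - 1)) =
      Real.pi / (2 * (Real.Gamma α * Real.sin (Real.pi * α / 2))) := by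
  have hG : 0 < Real.Gamma α := Real.Gamma_pos_of_pos hα0
  have hs : 0 < Real.sin (Real.pi * α / 2) :=
    Real.sin_pos_of_pos_of_lt_pi (by positivity) (by nlinarith [Real.pi_pos])
  rw [integral_eq_lintegral_of_nonneg_ae, lintegral_one_sub_cos_mul_rpow hα0 hα2,
    ENNReal.toReal_ofReal (by positivity)]
  · filter_upwards [ae_restrict_mem measurableSet_Ioi] with z hz
    exact mul_nonneg hα0.le (one_sub_cos_mul_rpow_nonneg hz)
  · exact (integrableOn_one_sub_cos_mul_rpow hα0 hα2).aestronglyMeasurable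

lemma one_sub_cos_mul_rpow_le_sq {z α : ℝ} (hz : 0 ≤ z) (hα2 : α < 2) :
    (1 - Real.cos z) * z ^ (-α) ≤ z ^ (2 - α) := by
  rcases hz.eq_or_lt with rfl | hz'
  · simp [Real.zero_rpow (show 2 - α ≠ 0 by linarith)]
  · rw [sub_eq_add_neg 2 α, Real.rpow_add hz', Real.rpow_two]
    gcongr
    nlinarith [Real.one_sub_sq_div_two_le_cos (x := z), sq_nonneg z]

lemma intervalIntegrable_sin_mul_rpow {α M : ℝ} (hα2 : α < 2) (hM : 0 ≤ M) :
    IntervalIntegrable (fun z : ℝ => Real.sin z * z ^ (-α)) volume 0 M := by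
  refine (intervalIntegral.intervalIntegrable_rpow' (r := 1 - α) (by linarith)).mono_fun
    (Measurable.aestronglyMeasurable (by fun_prop)) ?_
  rw [Set.uIoc_of_le hM]
  filter_upwards [ae_restrict_mem measurableSet_Ioc] with z hz
  have hz' : 0 < z := hz.1
  rw [norm_mul, sub_eq_add_neg, Real.rpow_add hz', norm_mul, Real.rpow_one]
  gcongr
  exact Real.abs_sin_le_abs

lemma integral_sin_mul_rpow {α M : ℝ} (hα0 : 0 < α) (hα2 : α < 2) (hM : 0 ≤ M) :
    ∫ z in (0)..M, Real.sin z * z ^ (-α) =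
      (1 - Real.cos M) * M ^ (-α) + ∫ z in (0)..M, α * ((1 - Real.cos z) * z ^ (-α - 1)) := by
  have hi : IntervalIntegrable (fun z : ℝ => α * ((1 - Real.cos z) * z ^ (-α - 1))) volume 0 M :=
    (intervalIntegrable_iff_integrableOn_Ioc_of_le hM).2
      ((integrableOn_one_sub_cos_mul_rpow hα0 hα2).mono_set Set.Ioc_subset_Ioi_self)
  have hs := intervalIntegrable_sin_mul_rpow hα2 hM
  rw [← sub_eq_iff_eq_add, ← intervalIntegral.integral_sub hs hi,
    intervalIntegral.integral_eq_sub_of_hasDerivAt_of_le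
      (f := fun z => (1 - Real.cos z) * z ^ (-α)) hM _ _ (hs.sub hi)]
  · simp
  · intro x hx
    rcases hx.1.eq_or_lt with rfl | hx0
    · have h0 : Tendsto (fun z : ℝ => z ^ (2 - α)) (nhdsWithin 0 (Set.Icc 0 M)) (nhds 0) := by
        have := (Real.continuousAt_rpow_const 0 (2 - α) (Or.inr (by linarith))).tendsto
        rw [Real.zero_rpow (by linarith)] at this
        exact this.mono_left nhdsWithin_le_nhds
      have h1 : Tendsto (fun z : ℝ => (1 - Real.cos z) * z ^ (-α))
          (nhdsWithin 0 (Set.Icc 0 M)) (nhds 0) := by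
        refine squeeze_zero' ?_ ?_ h0
        · filter_upwards [self_mem_nhdsWithin] with z hz
          exact mul_nonneg (by linarith [Real.cos_le_one z]) (Real.rpow_nonneg hz.1 _)
        · filter_upwards [self_mem_nhdsWithin] with z hz
          exact one_sub_cos_mul_rpow_le_sq hz.1 hα2
      simpa [ContinuousWithinAt] using h1
    · exact ((continuousAt_const.sub Real.continuous_cos.continuousAt).mul
        (Real.continuousAt_rpow_const _ _ (Or.inl hx0.ne'))).continuousWithinAt
  · intro x hx
    refine (((Real.hasDerivAt_cos x).const_sub 1).mul
      (Real.hasDerivAt_rpow_const (Or.inl hx.1.ne'))).congr_deriv ?_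
    ring

lemma tendsto_integral_sin_mul_rpow {α : ℝ} (hα0 : 0 < α) (hα2 : α < 2) :
    Tendsto (fun M : ℝ => ∫ z in (0)..M, Real.sin z * z ^ (-α)) atTop
      (nhds (Real.pi / (2 * (Real.Gamma α * Real.sin (Real.pi * α / 2))))) := by
  have h1 := intervalIntegral_tendsto_integral_Ioi 0
    (integrableOn_one_sub_cos_mul_rpow hα0 hα2) tendsto_id
  rw [integral_one_sub_cos_mul_rpow hα0 hα2] at h1
  have h2 : Tendsto (fun M : ℝ => (1 - Real.cos M) * M ^ (-α)) atTop (nhds 0) := by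
    have h3 := (tendsto_rpow_neg_atTop hα0).const_mul 2
    rw [mul_zero] at h3
    refine squeeze_zero' ?_ ?_ h3
    · filter_upwards [eventually_gt_atTop 0] with M hM
      exact one_sub_cos_mul_rpow_nonneg hM
    · filter_upwards [eventually_gt_atTop 0] with M hM
      gcongr
      linarith [Real.neg_one_le_cos M]
  have h4 := h2.add h1
  rw [zero_add] at h4
  refine h4.congr' ?_
  filter_upwards [eventually_ge_atTop 0] with M hM
  exact (integral_sin_mul_rpow hα0 hα2 hM).symm

lemma exists_potter_bound {G : ℝ → ℝ} (hG : Antitone G) (hpos : ∀ x, 0 < G x) {α β : ℝ}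
    (hαβ : α < β) (hβ : 0 < β)
    (hrv : Tendsto (fun x => G (2 * x) / G x) atTop (nhds (2 ^ (-α)))) :
    ∃ K x₀ : ℝ, ∀ x ≥ x₀, ∀ z : ℝ, 0 < z → z ≤ 1 → G (z * x) ≤ K * z ^ (-β) * G x := by
  have h2 : (2 : ℝ) ^ (-β) < 2 ^ (-α) :=
    Real.rpow_lt_rpow_of_exponent_lt one_lt_two (by linarith)
  obtain ⟨x₁, hx₁⟩ := eventually_atTop.1 (hrv.eventually_const_lt h2)
  set x₀ := max x₁ 1
  have hx₀ : 0 < x₀ := lt_of_lt_of_le one_pos (le_max_right _ _)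
  have hstep : ∀ x ≥ x₀, G x ≤ 2 ^ β * G (2 * x) := by
    intro x hx
    have := hx₁ x ((le_max_left _ _).trans hx)
    rw [lt_div_iff₀ (hpos x), Real.rpow_neg two_pos.le, inv_mul_lt_iff₀ (by positivity)] at this
    exact this.le
  have hpow : ∀ n : ℕ, ∀ x ≥ x₀, G x ≤ (2 ^ β) ^ n * G (2 ^ n * x) := by
    intro n
    induction n with
    | zero => intro x _; simp
    | succ n ih =>
      intro x hx
      have hx' : x₀ ≤ 2 * x := by linarith
      calc G x ≤ 2 ^ β * G (2 * x) := hstep x hx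
        _ ≤ 2 ^ β * ((2 ^ β) ^ n * G (2 ^ n * (2 * x))) := by gcongr; exact ih _ hx'
        _ = (2 ^ β) ^ (n + 1) * G (2 ^ (n + 1) * x) := by rw [← mul_assoc]; ring_nf
  have hmain : ∀ x z : ℝ, 0 < z → z ≤ 1 → x₀ ≤ z * x → G (z * x) ≤ 2 ^ β * z ^ (-β) * G x := by
    intro x z hz hz1 hzx
    have hx : 0 < x := pos_of_mul_pos_right (hx₀.trans_le hzx) hz.le
    obtain ⟨n, hn, hn'⟩ := exists_nat_pow_near (one_le_inv_iff₀.2 ⟨hz, hz1⟩) one_lt_two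
    have h3 : x ≤ 2 ^ (n + 1) * (z * x) := by
      have : 1 ≤ 2 ^ (n + 1) * z := by
        rw [inv_lt_iff_one_lt_mul₀ hz] at hn'
        linarith
      nlinarith
    have h4 : ((2 : ℝ) ^ β) ^ n ≤ z ^ (-β) := by
      rw [← Real.rpow_natCast, ← Real.rpow_mul two_pos.le, mul_comm, Real.rpow_mul two_pos.le,
        Real.rpow_natCast, Real.rpow_neg hz.le, ← Real.inv_rpow hz.le]
      gcongr
    calc G (z * x) ≤ (2 ^ β) ^ (n + 1) * G (2 ^ (n + 1) * (z * x)) := hpow _ _ hzx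
      _ ≤ (2 ^ β) ^ (n + 1) * G x := by gcongr; exact hG h3
      _ = 2 ^ β * (2 ^ β) ^ n * G x := by rw [pow_succ']
      _ ≤ 2 ^ β * z ^ (-β) * G x := by have := hpos x; gcongr
  refine ⟨2 ^ β * (1 + G 0 / G x₀), x₀, fun x hx z hz hz1 => ?_⟩
  have hx0 : 0 < x := hx₀.trans_le hx
  have hG0 := hpos 0
  have hGx := hpos x
  have hGx₀ := hpos x₀
  rcases le_or_gt x₀ (z * x) with h5 | h5
  · calc G (z * x) ≤ 2 ^ β * z ^ (-β) * G x := hmain x z hz hz1 h5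
      _ ≤ 2 ^ β * (1 + G 0 / G x₀) * z ^ (-β) * G x := by
        gcongr
        refine le_mul_of_one_le_right (by positivity) ?_
        have : 0 ≤ G 0 / G x₀ := by positivity
        linarith
  · have h6 := hmain x (x₀ / x) (by positivity) ((div_le_one hx0).2 hx)
      (by rw [div_mul_cancel₀ _ hx0.ne'])
    rw [div_mul_cancel₀ _ hx0.ne'] at h6
    have h7 : (x₀ / x) ^ (-β) ≤ z ^ (-β) :=
      Real.rpow_le_rpow_of_nonpos hz ((le_div_iff₀ hx0).2 h5.le) (by linarith)
    calc G (z * x) ≤ G 0 := hG (by positivity)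
      _ = G 0 / G x₀ * G x₀ := by field_simp
      _ ≤ (1 + G 0 / G x₀) * (2 ^ β * z ^ (-β) * G x) := by
        refine mul_le_mul (by linarith) (h6.trans ?_) hGx₀.le (by positivity)
        gcongr
      _ = 2 ^ β * (1 + G 0 / G x₀) * z ^ (-β) * G x := by ring

lemma tendsto_integral_sin_mul_tail {G : ℝ → ℝ} (hG : Antitone G) (hpos : ∀ x, 0 < G x) {α : ℝ}
    (hα0 : 0 < α) (hα2 : α < 2)
    (hrv : ∀ c > 0, Tendsto (fun x => G (c * x) / G x) atTop (nhds (c ^ (-α))))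
    {M : ℝ} (hM : 0 ≤ M) :
    Tendsto (fun x => ∫ z in (0)..M, Real.sin z * (G (z * x) / G x)) atTop
      (nhds (∫ z in (0)..M, Real.sin z * z ^ (-α))) := by
  obtain ⟨K, x₀, hK⟩ := exists_potter_bound hG hpos (α := α) (β := (α + 2) / 2) (by linarith)
    (by linarith) (hrv 2 two_pos)
  have hi : IntervalIntegrable (fun z : ℝ => z ^ (1 + -((α + 2) / 2))) volume 0 M :=
    intervalIntegral.intervalIntegrable_rpow' (by linarith)
  refine intervalIntegral.tendsto_integral_filter_of_dominated_convergence
    (fun z => |K| * z ^ (1 + -((α + 2) / 2)) + 1) ?_ ?_ ((hi.const_mul _).add (by simp)) ?_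
  · filter_upwards with x
    have : Measurable G := hG.measurable
    exact Measurable.aestronglyMeasurable (by fun_prop)
  · filter_upwards [eventually_ge_atTop x₀, eventually_gt_atTop 0] with x hx hx0
    filter_upwards with z hz
    rw [Set.uIoc_of_le hM] at hz
    have hz0 : 0 < z := hz.1
    have hGx := hpos x
    have hGz := hpos (z * x)
    rw [norm_mul, Real.norm_eq_abs, Real.norm_eq_abs, abs_of_pos (div_pos hGz hGx)]
    rcases le_or_gt z 1 with hz1 | hz1
    · calc |Real.sin z| * (G (z * x) / G x) ≤ z * (|K| * z ^ (-((α + 2) / 2))) := by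
            refine mul_le_mul ?_ ?_ (by positivity) hz0.le
            · simpa [abs_of_pos hz0] using Real.abs_sin_le_abs (x := z)
            · rw [div_le_iff₀ hGx]
              refine (hK x hx z hz0 hz1).trans ?_
              gcongr
              exact le_abs_self K
        _ = |K| * z ^ (1 + -((α + 2) / 2)) := by
            rw [Real.rpow_add hz0, Real.rpow_one]; ring
        _ ≤ _ := by linarith
    · calc |Real.sin z| * (G (z * x) / G x) ≤ 1 * 1 := by
            refine mul_le_mul (Real.abs_sin_le_one z) ?_ (by positivity) one_pos.le
            rw [div_le_one hGx]
            exact hG (by nlinarith)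
        _ ≤ _ := by
            have : 0 ≤ |K| * z ^ (1 + -((α + 2) / 2)) := by positivity
            linarith
  · filter_upwards with z hz
    rw [Set.uIoc_of_le hM] at hz
    exact (hrv z hz.1).const_mul _

lemma one_sub_cos_min_eq_integral {a M : ℝ} (ha : 0 ≤ a) (hM : 0 ≤ M) :
    1 - Real.cos (min a M) = ∫ z in Set.Ioc 0 M, if z ≤ a then Real.sin z else 0 := by
  have h1 : (fun z => if z ≤ a then Real.sin z else 0) = (Set.Iic a).indicator Real.sin := by
    ext z
    simp [Set.indicator_apply]
  rw [h1, setIntegral_indicator measurableSet_Iic, Set.Ioc_inter_Iic, min_comm,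
    ← intervalIntegral.integral_of_le (le_min hM ha), integral_sin, Real.cos_zero]

lemma measureReal_le_abs {μ : Measure ℝ} [IsFiniteMeasure μ]
    (hμ_symm : μ.map (fun x => -x) = μ) {a : ℝ} (ha : 0 < a) :
    μ.real {y | a ≤ |y|} = 2 * μ.real (Set.Ici a) := by
  have h1 : {y : ℝ | a ≤ |y|} = Set.Ici a ∪ Set.Iic (-a) := by
    ext y
    simp [le_abs, le_neg]
  have h2 : μ.real (Set.Iic (-a)) = μ.real (Set.Ici a) := by
    conv_rhs => rw [← hμ_symm]
    rw [map_measureReal_apply measurable_neg measurableSet_Ici]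
    congr 1
    ext y
    simp
  rw [h1, measureReal_union _ measurableSet_Iic, h2, two_mul]
  rw [Set.disjoint_left]
  intro y hy hy'
  simp only [Set.mem_Ici, Set.mem_Iic] at hy hy'
  linarith

lemma integral_one_sub_cos_min {μ : Measure ℝ} [IsFiniteMeasure μ]
    (hμ_symm : μ.map (fun x => -x) = μ) {x M : ℝ} (hx : 0 < x) (hM : 0 ≤ M) :
    ∫ y, (1 - Real.cos (min (|y| / x) M)) ∂μ =
      2 * ∫ z in (0)..M, Real.sin z * μ.real (Set.Ici (z * x)) := by
  have h1 : ∀ y : ℝ, 1 - Real.cos (min (|y| / x) M) =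
      ∫ z in Set.Ioc 0 M, if z ≤ |y| / x then Real.sin z else 0 :=
    fun y => one_sub_cos_min_eq_integral (by positivity) hM
  simp_rw [h1]
  rw [integral_integral_swap, intervalIntegral.integral_of_le hM, ← integral_const_mul]
  · refine setIntegral_congr_fun measurableSet_Ioc fun z hz => ?_
    have h2 : (fun y : ℝ => if z ≤ |y| / x then Real.sin z else 0) =
        {y : ℝ | z * x ≤ |y|}.indicator fun _ => Real.sin z := by
      ext y
      simp [Set.indicator_apply, le_div_iff₀ hx]
    simp only [h2]
    rw [integral_indicator_const _ (measurableSet_le measurable_const (by fun_prop)),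
      measureReal_le_abs hμ_symm (mul_pos hz.1 hx), smul_eq_mul]
    ring
  · refine Integrable.of_bound (C := 1) (Measurable.aestronglyMeasurable ?_) ?_
    · exact Measurable.ite (measurableSet_le (by fun_prop) (by fun_prop)) (by fun_prop)
        (by fun_prop)
    · filter_upwards with p
      simp only [Function.uncurry]
      split_ifs
      · exact Real.abs_sin_le_one _
      · simp

lemma abs_integral_one_sub_cos_sub_le {μ : Measure ℝ} [IsFiniteMeasure μ]
    (hμ_symm : μ.map (fun x => -x) = μ) {x M : ℝ} (hx : 0 < x) (hM : 0 < M) :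
    |∫ y, (1 - Real.cos (y / x)) ∂μ - ∫ y, (1 - Real.cos (min (|y| / x) M)) ∂μ| ≤
      4 * μ.real (Set.Ici (M * x)) := by
  have hb : ∀ f : ℝ → ℝ, Measurable f → Integrable (fun y => 1 - Real.cos (f y)) μ := by
    intro f hf
    refine Integrable.of_bound (C := 2) (Measurable.aestronglyMeasurable (by fun_prop)) ?_
    filter_upwards with y
    rw [Real.norm_eq_abs, abs_le]
    constructor <;> linarith [Real.cos_le_one (f y), Real.neg_one_le_cos (f y)]
  have hms : MeasurableSet {y : ℝ | M * x ≤ |y|} :=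
    measurableSet_le measurable_const (by fun_prop)
  rw [← integral_sub (hb _ (by fun_prop)) (hb _ (by fun_prop)), ← Real.norm_eq_abs]
  calc ‖∫ y, ((1 - Real.cos (y / x)) - (1 - Real.cos (min (|y| / x) M))) ∂μ‖
      ≤ ∫ y, {y : ℝ | M * x ≤ |y|}.indicator (fun _ => (2 : ℝ)) y ∂μ := by
        refine norm_integral_le_of_norm_le ((integrable_const _).indicator hms) ?_
        filter_upwards with y
        rw [Real.norm_eq_abs]
        by_cases h : M * x ≤ |y|
        · rw [Set.indicator_of_mem (show y ∈ {y : ℝ | M * x ≤ |y|} from h), abs_le]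
          constructor <;> linarith [Real.cos_le_one (y / x), Real.neg_one_le_cos (y / x),
            Real.cos_le_one (min (|y| / x) M), Real.neg_one_le_cos (min (|y| / x) M)]
        · rw [Set.indicator_of_notMem (show y ∉ {y : ℝ | M * x ≤ |y|} from h)]
          have h1 : |y| / x ≤ M := (div_le_iff₀ hx).2 (not_le.1 h).le
          rw [min_eq_left h1, ← Real.cos_abs (y / x), abs_div, abs_of_pos hx]
          simp
    _ = 4 * μ.real (Set.Ici (M * x)) := by
        rw [integral_indicator_const _ hms, measureReal_le_abs hμ_symm (mul_pos hM hx),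
          smul_eq_mul]
        ring

lemma tendsto_integral_one_sub_cos_div_tail {μ : Measure ℝ} [IsFiniteMeasure μ]
    (hμ_symm : μ.map (fun x => -x) = μ) {α : ℝ} (hα0 : 0 < α) (hα2 : α < 2)
    (hpos : ∀ x, 0 < μ.real (Set.Ici x))
    (hrv : ∀ c > 0, Tendsto (fun x => μ.real (Set.Ici (c * x)) / μ.real (Set.Ici x)) atTop
      (nhds (c ^ (-α)))) :
    Tendsto (fun x => (∫ y, (1 - Real.cos (y / x)) ∂μ) / μ.real (Set.Ici x)) atTop
      (nhds (Real.pi / (Real.Gamma α * Real.sin (Real.pi * α / 2)))) := by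
  set C := Real.pi / (Real.Gamma α * Real.sin (Real.pi * α / 2)) with hC
  have hanti : Antitone fun x => μ.real (Set.Ici x) :=
    fun a b hab => measureReal_mono (Set.Ici_subset_Ici.2 hab)
  have hlim : Tendsto (fun M : ℝ => 2 * ∫ z in (0)..M, Real.sin z * z ^ (-α)) atTop (nhds C) := by
    have := (tendsto_integral_sin_mul_rpow hα0 hα2).const_mul 2
    rwa [← div_div, mul_div_assoc', mul_div_assoc', mul_div_cancel_left₀ _ two_ne_zero] at this
  have htail : Tendsto (fun M : ℝ => 4 * M ^ (-α)) atTop (nhds 0) := by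
    simpa using (tendsto_rpow_neg_atTop hα0).const_mul 4
  rw [Metric.tendsto_nhds]
  intro ε hε
  obtain ⟨M, hM0, hM1, hM2⟩ := ((eventually_gt_atTop (0 : ℝ)).and
    (((Metric.tendsto_nhds.1 hlim) (ε / 3) (by positivity)).and
      (htail.eventually_lt_const (show 0 < ε / 3 by positivity)))).exists
  have hA := (tendsto_integral_sin_mul_tail hanti hpos hα0 hα2 hrv hM0.le).const_mul 2
  have hB := (hrv M hM0).const_mul 4
  filter_upwards [(Metric.tendsto_nhds.1 hA) (ε / 3) (by positivity),
    hB.eventually_lt_const hM2, eventually_gt_atTop 0] with x h1 h2 hx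
  have hGx := hpos x
  have h3 : |(∫ y, (1 - Real.cos (y / x)) ∂μ) / μ.real (Set.Ici x) -
      2 * ∫ z in (0)..M, Real.sin z * (μ.real (Set.Ici (z * x)) / μ.real (Set.Ici x))| < ε / 3 := by
    refine lt_of_le_of_lt ?_ h2
    have h4 := abs_integral_one_sub_cos_sub_le hμ_symm hx hM0
    rw [integral_one_sub_cos_min hμ_symm hx hM0.le] at h4
    simp_rw [← mul_div_assoc]
    rw [intervalIntegral.integral_div, ← mul_div_assoc, ← sub_div, abs_div, abs_of_pos hGx]
    gcongr
  rw [Real.dist_eq] at h1 hM1 ⊢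
  rw [abs_lt] at *
  constructor <;> linarith [h1.1, h1.2, hM1.1, hM1.2, h3.1, h3.2]

lemma tendsto_quantile {G h : ℝ → ℝ} (hG : Antitone G) (hpos : ∀ x, 0 < G x)
    (hG0 : Tendsto G atTop (nhds 0)) (hh : ∀ y, h y = sInf {x : ℝ | 0 ≤ x ∧ G x ≤ y}) :
    Tendsto h (nhdsWithin 0 (Set.Ioi 0)) atTop := by
  refine tendsto_atTop.2 fun A => ?_
  filter_upwards [self_mem_nhdsWithin,
    mem_nhdsWithin_of_mem_nhds (Iio_mem_nhds (hpos A))] with y hy hyA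
  have hy' : (0 : ℝ) < y := hy
  obtain ⟨x, hx0, hx⟩ := ((eventually_ge_atTop (0 : ℝ)).and (hG0.eventually_lt_const hy')).exists
  rw [hh]
  refine le_csInf ⟨x, hx0, hx.le⟩ fun z hz => ?_
  by_contra hlt
  exact absurd (hG (not_le.1 hlt).le) (not_le.2 (hz.2.trans_lt hyA))

lemma tendsto_apply_quantile_div {G h : ℝ → ℝ} (hG : Antitone G) (hpos : ∀ x, 0 < G x)
    (hG0 : Tendsto G atTop (nhds 0)) (hh : ∀ y, h y = sInf {x : ℝ | 0 ≤ x ∧ G x ≤ y}) {α : ℝ}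
    (hrv : ∀ c > 0, Tendsto (fun x => G (c * x) / G x) atTop (nhds (c ^ (-α)))) :
    Tendsto (fun y => G (h y) / y) (nhdsWithin 0 (Set.Ioi 0)) (nhds 1) := by
  have hht := tendsto_quantile hG hpos hG0 hh
  have hlim : ∀ c > 0, Tendsto (fun y => G (h y) / G (c * h y)) (nhdsWithin 0 (Set.Ioi 0))
      (nhds (c ^ α)) := by
    intro c hc
    have := ((hrv c hc).comp hht).inv₀ (Real.rpow_pos_of_pos hc _).ne'
    rw [Real.rpow_neg hc.le, inv_inv] at this
    refine this.congr fun y => ?_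
    simp
  have hc1 : Tendsto (fun c : ℝ => c ^ α) (nhds 1) (nhds 1) := by
    simpa using (Real.continuousAt_rpow_const 1 α (Or.inl one_ne_zero)).tendsto
  refine tendsto_order.2 ⟨fun a ha => ?_, fun a ha => ?_⟩
  · obtain ⟨c, hca, hc⟩ := (((hc1.mono_left nhdsWithin_le_nhds).eventually_const_lt ha).and
      (Ioo_mem_nhdsLT (zero_lt_one (α := ℝ)))).exists
    filter_upwards [(hlim c hc.1).eventually_const_lt hca, self_mem_nhdsWithin,
      hht.eventually_gt_atTop 0] with y h1 hy hhy
    have hy' : (0 : ℝ) < y := hy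
    refine h1.trans_le (div_le_div_of_nonneg_left (hpos _).le hy' ?_)
    by_contra hlt
    have h2 : h y ≤ c * h y := by
      conv_lhs => rw [hh y]
      exact csInf_le ⟨0, fun _ hz => hz.1⟩ ⟨mul_nonneg hc.1.le hhy.le, (not_le.1 hlt).le⟩
    nlinarith [hc.2]
  · obtain ⟨c, hca, hc⟩ := (((hc1.mono_left nhdsWithin_le_nhds).eventually_lt_const ha).and
      (self_mem_nhdsWithin (a := (1 : ℝ)) (s := Set.Ioi 1))).exists
    have hc' : 1 < c := hc
    filter_upwards [(hlim c (by linarith)).eventually_lt_const hca, self_mem_nhdsWithin,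
      hht.eventually_gt_atTop 0] with y h1 hy hhy
    have hy' : (0 : ℝ) < y := hy
    refine (div_le_div_of_nonneg_left (hpos _).le (hpos _) ?_).trans_lt h1
    obtain ⟨x, hx0, hx⟩ := ((eventually_ge_atTop (0 : ℝ)).and (hG0.eventually_lt_const hy')).exists
    have h2 : sInf {x : ℝ | 0 ≤ x ∧ G x ≤ y} < c * h y := by
      rw [← hh y]
      nlinarith
    obtain ⟨z, hz, hzc⟩ := exists_lt_of_csInf_lt (Set.nonempty_of_mem
      (show x ∈ {x : ℝ | 0 ≤ x ∧ G x ≤ y} from ⟨hx0, hx.le⟩)) h2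
    exact (hG hzc.le).trans hz.2

lemma tendsto_measureReal_Ici_atTop {μ : Measure ℝ} [IsFiniteMeasure μ] :
    Tendsto (fun x => μ.real (Set.Ici x)) atTop (nhds 0) := by
  have h1 : Tendsto (fun x => μ (Set.Ici x)) atTop (nhds (μ (⋂ x : ℝ, Set.Ici x))) :=
    tendsto_measure_iInter_atTop (fun _ => measurableSet_Ici.nullMeasurableSet)
      (fun _ _ hab => Set.Ici_subset_Ici.2 hab) ⟨0, measure_ne_top _ _⟩
  have h2 : ⋂ x : ℝ, Set.Ici x = ∅ := by
    ext y
    simp only [Set.mem_iInter, Set.mem_Ici, Set.mem_empty_iff_false, iff_false, not_forall, not_le]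
    exact ⟨y + 1, lt_add_one y⟩
  rw [h2, measure_empty] at h1
  exact (ENNReal.tendsto_toReal ENNReal.zero_ne_top).comp h1

lemma eq_integral_cos_of_eq_integral_exp {μ : Measure ℝ} [IsFiniteMeasure μ] {R : ℝ → ℝ}
    (hR : ∀ t : ℝ, (R t : ℂ) = ∫ x : ℝ, Complex.exp (Complex.I * t * x) ∂μ) (t : ℝ) :
    R t = ∫ x, Real.cos (t * x) ∂μ := by
  have h1 : ∀ x : ℝ, Complex.I * t * x = ((t * x : ℝ) : ℂ) * Complex.I := by
    intro x
    push_cast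
    ring
  have hi : Integrable (fun x : ℝ => Complex.exp (Complex.I * t * x)) μ := by
    refine Integrable.of_bound (C := 1) (Continuous.aestronglyMeasurable (by fun_prop)) ?_
    filter_upwards with x
    rw [h1, Complex.norm_exp_ofReal_mul_I]
  have h2 := integral_re hi
  rw [← hR t] at h2
  simp only [h1, RCLike.re_eq_complex_re, Complex.exp_ofReal_mul_I_re, Complex.ofReal_re] at h2
  exact h2.symm

lemma sub_eq_integral_one_sub_cos {μ : Measure ℝ} [IsFiniteMeasure μ] {R : ℝ → ℝ}
    (hR : ∀ t : ℝ, (R t : ℂ) = ∫ x : ℝ, Complex.exp (Complex.I * t * x) ∂μ) (t : ℝ) :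
    R 0 - R t = ∫ x, (1 - Real.cos (t * x)) ∂μ := by
  rw [eq_integral_cos_of_eq_integral_exp hR, eq_integral_cos_of_eq_integral_exp hR,
    ← integral_sub]
  · simp
  · simp
  · refine Integrable.of_bound (C := 1) (Continuous.aestronglyMeasurable (by fun_prop)) ?_
    filter_upwards with x
    exact Real.abs_cos_le_one _

lemma tendsto_covariance_increment_div {μ : Measure ℝ} [IsFiniteMeasure μ]
    (hμ_symm : μ.map (fun x => -x) = μ) {α : ℝ} (hα0 : 0 < α) (hα2 : α < 2)
    (hpos : ∀ x, 0 < μ.real (Set.Ici x))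
    (hrv : ∀ c > 0, Tendsto (fun x => μ.real (Set.Ici (c * x)) / μ.real (Set.Ici x)) atTop
      (nhds (c ^ (-α))))
    {R : ℝ → ℝ} (hR : ∀ t : ℝ, (R t : ℂ) = ∫ x : ℝ, Complex.exp (Complex.I * t * x) ∂μ)
    {h : ℝ → ℝ} (hh : ∀ y, h y = sInf {x : ℝ | 0 ≤ x ∧ μ.real (Set.Ici x) ≤ y}) (r : ℝ) :
    Tendsto (fun y => (R 0 - R (r * (h y)⁻¹)) / y) (nhdsWithin 0 (Set.Ioi 0))
      (nhds (Real.pi / (Real.Gamma α * Real.sin (Real.pi * α / 2)) * |r| ^ α)) := by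
  rcases eq_or_ne r 0 with rfl | hr
  · simp [Real.zero_rpow hα0.ne']
  have hr' : 0 < |r| := abs_pos.2 hr
  have hanti : Antitone fun x => μ.real (Set.Ici x) :=
    fun a b hab => measureReal_mono (Set.Ici_subset_Ici.2 hab)
  have hht := tendsto_quantile hanti hpos tendsto_measureReal_Ici_atTop hh
  have h1 := (tendsto_integral_one_sub_cos_div_tail hμ_symm hα0 hα2 hpos hrv).comp
    (hht.const_mul_atTop (inv_pos.2 hr'))
  have h2 := (hrv _ (inv_pos.2 hr')).comp hht
  have h3 := tendsto_apply_quantile_div hanti hpos tendsto_measureReal_Ici_atTop hh hrv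
  have h4 := (h1.mul h2).mul h3
  rw [mul_one, Real.inv_rpow hr'.le, Real.rpow_neg hr'.le, inv_inv] at h4
  refine h4.congr' ?_
  filter_upwards [hht.eventually_gt_atTop 0] with y hy
  have h5 : ∀ x, Real.cos (x / (|r|⁻¹ * h y)) = Real.cos (r * (h y)⁻¹ * x) := by
    intro x
    rw [← Real.cos_abs, ← Real.cos_abs (r * (h y)⁻¹ * x)]
    congr 1
    simp only [abs_div, abs_mul, abs_inv, abs_abs]
    field_simp
  simp only [Function.comp_apply]
  rw [sub_eq_integral_one_sub_cos hR]
  simp_rw [h5]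
  have h6 := (hpos (|r|⁻¹ * h y)).ne'
  have h7 := (hpos (h y)).ne'
  rw [div_mul_div_cancel₀ h6, div_mul_div_cancel₀ h7]

lemma IsZeroMeanGaussianProcess.memLp_two {Ω : Type*} [MeasurableSpace Ω] {P : Measure Ω}
    {X : ℝ → Ω → ℝ} (hX : IsZeroMeanGaussianProcess P X) (t : ℝ) : MemLp (X t) 2 P := by
  obtain ⟨v, hv⟩ := hX.2 1 (fun _ => t) fun _ => 1
  simp only [Finset.univ_unique, one_mul, Finset.sum_const, Finset.card_singleton, one_smul] at hv
  have h1 : MemLp id 2 (P.map (X t)) := by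
    change P.map (X t) = _ at hv
    rw [hv]
    exact memLp_id_gaussianReal 2
  exact (memLp_map_measure_iff aestronglyMeasurable_id (hX.1 t).aemeasurable).1 h1

lemma integral_residual_mul_residual {Ω : Type*} [MeasurableSpace Ω] {P : Measure Ω}
    {X : ℝ → Ω → ℝ} {R : ℝ → ℝ} (hX : ∀ t, MemLp (X t) 2 P)
    (hX_cov : ∀ s t : ℝ, ∫ ω, X s ω * X t ω ∂P = R (s - t)) (hR0 : R 0 ≠ 0) (a b : ℝ) :
    ∫ ω, (X a ω - R a / R 0 * X 0 ω) * (X b ω - R b / R 0 * X 0 ω) ∂P =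
      (R 0 - R a) + (R 0 - R b) - (R 0 - R (a - b)) - (R 0)⁻¹ * ((R a - R 0) * (R b - R 0)) := by
  have hi : ∀ s t, Integrable (fun ω => X s ω * X t ω) P :=
    fun s t => (hX s).integrable_mul (hX t)
  have hb : R (0 - b) = R b := by
    rw [← hX_cov]
    simp_rw [mul_comm (X 0 _)]
    rw [hX_cov, sub_zero]
  have h1 : ∀ ω, (X a ω - R a / R 0 * X 0 ω) * (X b ω - R b / R 0 * X 0 ω) =
      (X a ω * X b ω - R b / R 0 * (X a ω * X 0 ω)) -
        (R a / R 0 * (X 0 ω * X b ω) - R a / R 0 * (R b / R 0) * (X 0 ω * X 0 ω)) := by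
    intro ω
    ring
  have h2 : ∀ (c d : ℝ) (p q r v : ℝ),
      Integrable (fun ω => c * (X p ω * X q ω) - d * (X r ω * X v ω)) P :=
    fun c d p q r v => ((hi p q).const_mul c).sub ((hi r v).const_mul d)
  have h3 : Integrable (fun ω => X a ω * X b ω - R b / R 0 * (X a ω * X 0 ω)) P := by
    simpa using h2 1 (R b / R 0) a b a 0
  simp_rw [h1]
  rw [integral_sub h3 (h2 _ _ _ _ _ _), integral_sub (hi _ _) ((hi _ _).const_mul _),
    integral_sub ((hi _ _).const_mul _) ((hi _ _).const_mul _)]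
  simp only [integral_const_mul, hX_cov, hb, sub_zero]
  field_simp
  ring

/-- with `Z_t = X_t - (R(t)/R(0)) X₀`, for fixed `s, t`:
the covariance identity
`E(Z_{sδ_u} Z_{tδ_u}) = [R(0)-R(sδ_u)] + [R(0)-R(tδ_u)] - [R(0)-R((s-t)δ_u)]
  - R(0)⁻¹ [R(sδ_u)-R(0)][R(tδ_u)-R(0)]` holds, and
`E(Z_{sδ_u} Z_{tδ_u}) ~ C_α u⁻² (|s|^α + |t|^α - |s-t|^α)` as `u → ∞`
(when the right-hand side does not vanish). -/
theorem excursion_stmt10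
    (α : ℝ) (hα0 : 0 < α) (hα2 : α < 2)
    (μ : Measure ℝ) [IsFiniteMeasure μ]
    (hμ_nonnull : μ Set.univ ≠ 0)
    (hμ_symm : μ.map (fun x => -x) = μ)
    (hμ_tail_pos : ∀ x > (0 : ℝ), 0 < μ (Set.Ici x))
    (hμ_rv : ∀ c > (0 : ℝ),
      Tendsto (fun x : ℝ => (μ (Set.Ici (c * x))).toReal / (μ (Set.Ici x)).toReal)
        atTop (nhds (c ^ (-α))))
    (R : ℝ → ℝ)
    (hR : ∀ t : ℝ, (R t : ℂ) = ∫ x : ℝ, Complex.exp (Complex.I * t * x) ∂μ)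
    {Ω : Type*} [MeasurableSpace Ω] (P : Measure Ω) [IsProbabilityMeasure P]
    (X : ℝ → Ω → ℝ)
    (hX_gauss : IsZeroMeanGaussianProcess P X)
    (hX_cov : ∀ s t : ℝ, ∫ ω, X s ω * X t ω ∂P = R (s - t))
    (Z : ℝ → Ω → ℝ)
    (hZ : ∀ t ω, Z t ω = X t ω - R t / R 0 * X 0 ω)
    (h : ℝ → ℝ)
    (hh : ∀ y : ℝ, h y = sInf {x : ℝ | 0 ≤ x ∧ (μ (Set.Ici x)).toReal ≤ y})
    (δ : ℝ → ℝ)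
    (hδ : ∀ u : ℝ, δ u = (h (u ^ (-2 : ℝ)))⁻¹)
    (s t : ℝ) :
    (∀ u > (0 : ℝ),
      ∫ ω, Z (s * δ u) ω * Z (t * δ u) ω ∂P
        = (R 0 - R (s * δ u)) + (R 0 - R (t * δ u)) - (R 0 - R ((s - t) * δ u))
          - (R 0)⁻¹ * ((R (s * δ u) - R 0) * (R (t * δ u) - R 0))) ∧
    (|s| ^ α + |t| ^ α - |s - t| ^ α ≠ 0 →
      Tendsto (fun u : ℝ =>
          (∫ ω, Z (s * δ u) ω * Z (t * δ u) ω ∂P) /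
            (Real.pi / (Real.Gamma α * Real.sin (Real.pi * α / 2)) * u ^ (-2 : ℝ)
              * (|s| ^ α + |t| ^ α - |s - t| ^ α)))
        atTop (nhds 1)) := by
  have hpos : ∀ x, 0 < μ.real (Set.Ici x) := by
    intro x
    have h1 := hμ_tail_pos (max x 1) (lt_of_lt_of_le one_pos (le_max_right _ _))
    exact ENNReal.toReal_pos (h1.trans_le (measure_mono (Set.Ici_subset_Ici.2
      (le_max_left _ _)))).ne' (measure_ne_top _ _)
  have hR0 : R 0 ≠ 0 := by
    rw [eq_integral_cos_of_eq_integral_exp hR]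
    simpa [Measure.real, ENNReal.toReal_eq_zero_iff] using hμ_nonnull
  have hid : ∀ u : ℝ, ∫ ω, Z (s * δ u) ω * Z (t * δ u) ω ∂P
        = (R 0 - R (s * δ u)) + (R 0 - R (t * δ u)) - (R 0 - R ((s - t) * δ u))
          - (R 0)⁻¹ * ((R (s * δ u) - R 0) * (R (t * δ u) - R 0)) := by
    intro u
    simp_rw [hZ]
    rw [integral_residual_mul_residual hX_gauss.memLp_two hX_cov hR0, ← sub_mul s t]
  refine ⟨fun u _ => hid u, fun hne => ?_⟩
  set C := Real.pi / (Real.Gamma α * Real.sin (Real.pi * α / 2)) with hC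
  have hCpos : 0 < C := by
    have hs : 0 < Real.sin (Real.pi * α / 2) :=
      Real.sin_pos_of_pos_of_lt_pi (by positivity) (by nlinarith [Real.pi_pos])
    have := Real.Gamma_pos_of_pos hα0
    positivity
  have hu : Tendsto (fun u : ℝ => u ^ (-2 : ℝ)) atTop (nhdsWithin 0 (Set.Ioi 0)) := by
    refine tendsto_nhdsWithin_iff.2 ⟨tendsto_rpow_neg_atTop two_pos, ?_⟩
    filter_upwards [eventually_gt_atTop 0] with u hu
    exact Real.rpow_pos_of_pos hu _
  have hD : ∀ r, Tendsto (fun u => (R 0 - R (r * δ u)) / u ^ (-2 : ℝ)) atTop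
      (nhds (C * |r| ^ α)) := by
    intro r
    simp_rw [hδ]
    exact (tendsto_covariance_increment_div hμ_symm hα0 hα2 hpos hμ_rv hR hh r).comp hu
  have hlim := ((((hD s).add (hD t)).sub (hD (s - t))).sub
    ((((hD s).mul (hD t)).const_mul (R 0)⁻¹).mul (tendsto_rpow_neg_atTop two_pos))).div_const
      (C * (|s| ^ α + |t| ^ α - |s - t| ^ α))
  rw [mul_zero, sub_zero, ← mul_add, ← mul_sub, div_self (mul_ne_zero hCpos.ne' hne)] at hlim
  refine hlim.congr' ?_
  filter_upwards [eventually_gt_atTop 0] with u hu0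
  have hy : u ^ (-2 : ℝ) ≠ 0 := (Real.rpow_pos_of_pos hu0 _).ne'
  rw [hid u]
  generalize u ^ (-2 : ℝ) = y at hy
  generalize |s| ^ α + |t| ^ α - |s - t| ^ α = q at hne
  have hC0 := hCpos.ne'
  field_simp
  ring
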